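/- arXiv:0708.1400 — 4 statements merged into one kernel-verified Lean document; each statement's English description precedes it below -/
import Mathlib

section
/- Let E be a 3-dimensional real inner product space with inner product g and orthonormal basis (e₁,e₂,e₃), and let ρ be a symmetric bilinear form on E with trace τ = Σᵢ ρ(eᵢ,eᵢ) and squared norm |ρ|² = Σ_{i,j} ρ(eᵢ,eⱼ)². If 23|ρ|² − 6τ² − 20τ + 60 = 0, then τ = 6 and ρ = 2g (i.e. ρ(X,Y) = 2g(X,Y) for all X,Y). -/
open scoped RealInnerProductSpace

/-- Equations (4-3) and (4-4): if a symmetric bilinear form `ρ` on a 3-dimensional real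
inner product space, with trace `τ` and squared norm `|ρ|²`, satisfies
`23|ρ|² − 6τ² − 20τ + 60 = 0`, then `τ = 6` and `ρ = 2g`. -/
theorem stmt_4 (E : Type*) [NormedAddCommGroup E] [InnerProductSpace ℝ E]
    (e : OrthonormalBasis (Fin 3) ℝ E)
    (ρ : E →ₗ[ℝ] E →ₗ[ℝ] ℝ) (hsym : ∀ X Y : E, ρ X Y = ρ Y X)
    (τ : ℝ) (hτ : τ = ∑ i, ρ (e i) (e i))
    (h : 23 * (∑ i, ∑ j, (ρ (e i) (e j)) ^ 2) - 6 * τ ^ 2 - 20 * τ + 60 = 0) :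
    τ = 6 ∧ ∀ X Y : E, ρ X Y = 2 * ⟪X, Y⟫ := by
  have hinner (i j : Fin 3) : ⟪e i, e j⟫ = if i = j then (1 : ℝ) else 0 :=
    orthonormal_iff_ite.mp e.orthonormal i j
  have key : 23 * ∑ i, ∑ j, (ρ (e i) (e j) - τ / 3 * ⟪e i, e j⟫) ^ 2
      + 5 / 3 * (τ - 6) ^ 2 = 0 := by
    rw [← h]
    simp only [hinner, Fin.sum_univ_three] at hτ ⊢
    norm_num [Fin.ext_iff]
    rw [hτ]
    ring
  have hnonneg : 0 ≤ ∑ i, ∑ j, (ρ (e i) (e j) - τ / 3 * ⟪e i, e j⟫) ^ 2 := by positivity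
  have hτ6 : τ = 6 := by nlinarith [sq_nonneg (τ - 6)]
  have hzero : ∑ i, ∑ j, (ρ (e i) (e j) - τ / 3 * ⟪e i, e j⟫) ^ 2 = 0 := by
    nlinarith [sq_nonneg (τ - 6)]
  have hentry (i j : Fin 3) : ρ (e i) (e j) = 2 * ⟪e i, e j⟫ := by
    rw [Fintype.sum_eq_zero_iff_of_nonneg (fun _ => by positivity)] at hzero
    have hrow := congrFun hzero i
    simp only [Pi.zero_apply] at hrow
    rw [Fintype.sum_eq_zero_iff_of_nonneg (fun _ => by positivity)] at hrow
    have hij := pow_eq_zero_iff two_ne_zero |>.mp (congrFun hrow j)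
    rw [hτ6] at hij
    linarith
  have hρ : ρ = (2 : ℝ) • innerₗ E :=
    e.toBasis.ext fun i => e.toBasis.ext fun j => by simpa using hentry i j
  exact ⟨hτ6, fun X Y => by simp [hρ]⟩
end

section
/- Let E be a 3-dimensional real inner product space with inner product g and orthonormal basis (e₁,e₂,e₃). Let ρ be a symmetric bilinear form on E with trace τ = Σᵢ ρ(eᵢ,eᵢ), and define the quadrilinear form R by R(X,Y,Z,W) = g(X,W)ρ(Y,Z) + g(Y,Z)ρ(X,W) − g(X,Z)ρ(Y,W) − g(Y,W)ρ(X,Z) + (τ/2)(g(X,Z)g(Y,W) − g(Y,Z)g(X,W)). Write |ρ|² = Σ_{i,j} ρ(eᵢ,eⱼ)² and |R|² = Σ_{i,j,k,l} R(eᵢ,eⱼ,e_k,e_l)². If 2|ρ|² − 12|R|² = −40τ + 120, then τ = 6, ρ = 2g, and R(X,Y,Z,W) = g(X,W)g(Y,Z) − g(X,Z)g(Y,W) for all X,Y,Z,W. -/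
open scoped RealInnerProductSpace

/-- In an orthonormal basis of a 3-dimensional space, `|R|² = 4|ρ|² − τ²` for the curvature form `R`
built from a symmetric Ricci form `ρ` with trace `τ`. -/
theorem sum_sq_curvature_eq {E : Type*} [NormedAddCommGroup E] [InnerProductSpace ℝ E]
    (e : OrthonormalBasis (Fin 3) ℝ E)
    (ρ : E →ₗ[ℝ] E →ₗ[ℝ] ℝ) (hsym : ∀ X Y : E, ρ X Y = ρ Y X)
    (τ : ℝ) (hτ : τ = ∑ i, ρ (e i) (e i))
    (R : E → E → E → E → ℝ)
    (hR : ∀ X Y Z W : E, R X Y Z W =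
      ⟪X, W⟫ * ρ Y Z + ⟪Y, Z⟫ * ρ X W - ⟪X, Z⟫ * ρ Y W - ⟪Y, W⟫ * ρ X Z
        + (τ / 2) * (⟪X, Z⟫ * ⟪Y, W⟫ - ⟪Y, Z⟫ * ⟪X, W⟫)) :
    ∑ i, ∑ j, ∑ k, ∑ l, (R (e i) (e j) (e k) (e l)) ^ 2
      = 4 * (∑ i, ∑ j, (ρ (e i) (e j)) ^ 2) - τ ^ 2 := by
  have h10 := hsym (e 1) (e 0)
  have h20 := hsym (e 2) (e 0)
  have h21 := hsym (e 2) (e 1)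
  simp only [Fin.sum_univ_three] at hτ
  simp only [hR, Fin.sum_univ_three, e.inner_eq_ite, h10, h20, h21, hτ]
  simp only [Fin.isValue, Fin.reduceEq, if_true, if_false, one_mul, zero_mul, mul_one, mul_zero]
  ring

/-- A bilinear form that agrees with `c` times the inner product on an orthonormal basis is
`c` times the inner product. -/
theorem bilin_eq_smul_inner {ι E : Type*} [Fintype ι] [NormedAddCommGroup E]
    [InnerProductSpace ℝ E] (e : OrthonormalBasis ι ℝ E) (ρ : E →ₗ[ℝ] E →ₗ[ℝ] ℝ) (c : ℝ)
    (h : ∀ i j, ρ (e i) (e j) = c * ⟪e i, e j⟫) (X Y : E) : ρ X Y = c * ⟪X, Y⟫ := by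
  have key : ρ = c • innerₗ E := e.toBasis.ext fun i => e.toBasis.ext fun j => by simp [h]
  simp [key]

/-- Algebraic core of Section 4, case (II): in dimension 3, if `R` is built from the
symmetric bilinear form `ρ` (with trace `τ`) by formula (4-1) and
`2|ρ|² − 12|R|² = −40τ + 120`, then `τ = 6`, `ρ = 2g` and
`R(X,Y,Z,W) = g(X,W)g(Y,Z) − g(X,Z)g(Y,W)` (constant sectional curvature 1). -/
theorem stmt_5 (E : Type*) [NormedAddCommGroup E] [InnerProductSpace ℝ E]
    (e : OrthonormalBasis (Fin 3) ℝ E)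
    (ρ : E →ₗ[ℝ] E →ₗ[ℝ] ℝ) (hsym : ∀ X Y : E, ρ X Y = ρ Y X)
    (τ : ℝ) (hτ : τ = ∑ i, ρ (e i) (e i))
    (R : E → E → E → E → ℝ)
    (hR : ∀ X Y Z W : E, R X Y Z W =
      ⟪X, W⟫ * ρ Y Z + ⟪Y, Z⟫ * ρ X W - ⟪X, Z⟫ * ρ Y W - ⟪Y, W⟫ * ρ X Z
        + (τ / 2) * (⟪X, Z⟫ * ⟪Y, W⟫ - ⟪Y, Z⟫ * ⟪X, W⟫))
    (h : 2 * (∑ i, ∑ j, (ρ (e i) (e j)) ^ 2)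
        - 12 * (∑ i, ∑ j, ∑ k, ∑ l, (R (e i) (e j) (e k) (e l)) ^ 2)
        = -40 * τ + 120) :
    τ = 6 ∧ (∀ X Y : E, ρ X Y = 2 * ⟪X, Y⟫) ∧
      ∀ X Y Z W : E, R X Y Z W = ⟪X, W⟫ * ⟪Y, Z⟫ - ⟪X, Z⟫ * ⟪Y, W⟫ := by
  have hnorm := sum_sq_curvature_eq e ρ hsym τ hτ R hR
  have hdev : ∑ i, ∑ j, (ρ (e i) (e j) - τ / 3 * ⟪e i, e j⟫) ^ 2
      = ∑ i, ∑ j, (ρ (e i) (e j)) ^ 2 - τ ^ 2 / 3 := by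
    simp only [Fin.sum_univ_three] at hτ
    simp only [Fin.sum_univ_three, e.inner_eq_ite, hτ]
    simp only [Fin.isValue, Fin.reduceEq, if_true, if_false, mul_one, mul_zero]
    ring
  have hnonneg : 0 ≤ ∑ i, ∑ j, (ρ (e i) (e j) - τ / 3 * ⟪e i, e j⟫) ^ 2 := by positivity
  have hτ6 : τ = 6 := by nlinarith [sq_nonneg (τ - 6)]
  have hzero : ∑ i, ∑ j, (ρ (e i) (e j) - τ / 3 * ⟪e i, e j⟫) ^ 2 = 0 := by
    nlinarith [sq_nonneg (τ - 6)]
  have hρ : ∀ X Y : E, ρ X Y = 2 * ⟪X, Y⟫ := by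
    refine bilin_eq_smul_inner e ρ 2 fun i j => ?_
    rw [Finset.sum_eq_zero_iff_of_nonneg fun _ _ => by positivity] at hzero
    have hi := hzero i (Finset.mem_univ i)
    rw [Finset.sum_eq_zero_iff_of_nonneg fun _ _ => by positivity] at hi
    have hij := pow_eq_zero_iff two_ne_zero |>.mp (hi j (Finset.mem_univ j))
    rw [hτ6] at hij
    linarith
  refine ⟨hτ6, hρ, fun X Y Z W => ?_⟩
  rw [hR, hρ, hρ, hρ, hρ, hτ6]
  ring
end

section
/- Let n ≥ 3 be a natural number and let τ, R2 be real numbers with R2 ≥ 2τ²/(n(n−1)). If 2·(τ²/n) − 3(n+1)·R2 = −4(n−1)(n+2)·τ + 4n(n−1)(n−2)(n+2), then n(n−1) ≤ τ ≤ n(n−1)(n−2). -/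
/-- Algebraic core of the Einstein case (Theorem 4.3 / inequality (4-7)):
if `R2 ≥ 2τ²/(n(n−1))` and relation (4.10) holds with `|ρ|² = τ²/n`, then
`n(n−1) ≤ τ ≤ n(n−1)(n−2)`. -/
theorem stmt_9 (n : ℕ) (hn : 3 ≤ n) (τ R2 : ℝ)
    (hR2 : R2 ≥ 2 * τ ^ 2 / ((n : ℝ) * ((n : ℝ) - 1)))
    (h : 2 * (τ ^ 2 / (n : ℝ)) - 3 * ((n : ℝ) + 1) * R2
      = -4 * ((n : ℝ) - 1) * ((n : ℝ) + 2) * τ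
        + 4 * (n : ℝ) * ((n : ℝ) - 1) * ((n : ℝ) - 2) * ((n : ℝ) + 2)) :
    (n : ℝ) * ((n : ℝ) - 1) ≤ τ ∧ τ ≤ (n : ℝ) * ((n : ℝ) - 1) * ((n : ℝ) - 2) := by
  have hn' : (3 : ℝ) ≤ n := by exact_mod_cast hn
  have hpos : 0 < (n : ℝ) * ((n : ℝ) - 1) := mul_pos (by linarith) (by linarith)
  have factorization : -3 * ((n : ℝ) + 1) * (R2 - 2 * τ ^ 2 / ((n : ℝ) * ((n : ℝ) - 1)))
      = 4 * ((n : ℝ) + 2) / ((n : ℝ) * ((n : ℝ) - 1))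
        * ((τ - (n : ℝ) * ((n : ℝ) - 1)) * (τ - (n : ℝ) * ((n : ℝ) - 1) * ((n : ℝ) - 2))) := by
    have hn0 : (n : ℝ) ≠ 0 := by linarith
    have hn1 : (n : ℝ) - 1 ≠ 0 := by linarith
    have hR : -3 * ((n : ℝ) + 1) * R2 = -4 * ((n : ℝ) - 1) * ((n : ℝ) + 2) * τ
        + 4 * (n : ℝ) * ((n : ℝ) - 1) * ((n : ℝ) - 2) * ((n : ℝ) + 2)
        - 2 * (τ ^ 2 / (n : ℝ)) := by linarith
    rw [mul_sub, hR]
    field_simp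
    ring
  have hprod : (τ - (n : ℝ) * ((n : ℝ) - 1)) * (τ - (n : ℝ) * ((n : ℝ) - 1) * ((n : ℝ) - 2))
      ≤ 0 := by
    have hc : 0 < 4 * ((n : ℝ) + 2) / ((n : ℝ) * ((n : ℝ) - 1)) :=
      div_pos (by linarith) hpos
    refine nonpos_of_mul_nonpos_right ?_ hc
    rw [← factorization]
    exact mul_nonpos_of_nonpos_of_nonneg (by linarith) (sub_nonneg.2 hR2)
  have hle : (n : ℝ) * ((n : ℝ) - 1) ≤ (n : ℝ) * ((n : ℝ) - 1) * ((n : ℝ) - 2) :=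
    le_mul_of_one_le_right hpos.le (by linarith)
  rcases mul_nonpos_iff.1 hprod with ⟨h₁, h₂⟩ | ⟨h₁, h₂⟩ <;> constructor <;> linarith
end

section
/- Let τ, α, a, b, c, d, e, f be real numbers satisfying: a + b + c = −τ/4; d + e + f = 0; d² = (a + τ/12)², e² = (b + τ/12)², f² = (c + τ/12)²; 2(a² + d²) = α − 8, 2(b² + e²) = α − 8, 2(c² + f²) = α − 8; and 2·(4(a+b+c)²) − 15·(8(a²+b²+c²+d²+e²+f²)) = −72τ + 576. Then a = b = c = −τ/12, d = e = f = 0, and τ = 12 or τ = 24. -/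
/-- The degenerate configuration with two components `-τ / 6` and the third `τ / 12` is
incompatible with the quadratic relation between the curvature norms. -/
theorem no_real_solution_of_two_eq (x y z τ : ℝ)
    (hx : x = -τ / 6) (hy : y = -τ / 6) (hz : z = τ / 12)
    (h : 2 * (4 * (-τ / 4) ^ 2)
        - 15 * (8 * (x ^ 2 + y ^ 2 + z ^ 2
          + (x + τ / 12) ^ 2 + (y + τ / 12) ^ 2 + (z + τ / 12) ^ 2)) = -72 * τ + 576) :
    False := by
  subst hx hy hz
  nlinarith [sq_nonneg (τ - 3)]


/-- Algebraic core of Theorem 1.3: the Singer–Thorpe components of the curvature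
tensor of a 4-dimensional Einstein manifold whose unit tangent bundle is
η-Einstein satisfy `a = b = c = −τ/12`, `d = e = f = 0`, and `τ = 12` or `τ = 24`. -/
theorem stmt_13 (τ α a b c d e f : ℝ)
    (h1 : a + b + c = -τ / 4)
    (h2 : d + e + f = 0)
    (hd : d ^ 2 = (a + τ / 12) ^ 2)
    (he : e ^ 2 = (b + τ / 12) ^ 2)
    (hf : f ^ 2 = (c + τ / 12) ^ 2)
    (ha : 2 * (a ^ 2 + d ^ 2) = α - 8)
    (hb : 2 * (b ^ 2 + e ^ 2) = α - 8)
    (hc : 2 * (c ^ 2 + f ^ 2) = α - 8)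
    (h410 : 2 * (4 * (a + b + c) ^ 2)
        - 15 * (8 * (a ^ 2 + b ^ 2 + c ^ 2 + d ^ 2 + e ^ 2 + f ^ 2))
      = -72 * τ + 576) :
    a = -τ / 12 ∧ b = -τ / 12 ∧ c = -τ / 12 ∧
    d = 0 ∧ e = 0 ∧ f = 0 ∧ (τ = 12 ∨ τ = 24) := by
  have hab : (a - b) * (c + τ / 6) = 0 := by
    obtain rfl : c = -τ / 4 - a - b := by linarith
    linear_combination (-1 / 4) * (ha - hb) + (1 / 2) * (hd - he)
  have hbc : (b - c) * (a + τ / 6) = 0 := by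
    obtain rfl : c = -τ / 4 - a - b := by linarith
    linear_combination (-1 / 4) * (hb - hc) + (1 / 2) * (he - hf)
  have hac : (a - c) * (b + τ / 6) = 0 := by
    obtain rfl : c = -τ / 4 - a - b := by linarith
    linear_combination (-1 / 4) * (ha - hc) + (1 / 2) * (hd - hf)
  have key : a = b ∧ b = c := by
    rw [h1, hd, he, hf] at h410
    rcases mul_eq_zero.mp hab with p | p
    · rcases mul_eq_zero.mp hbc with q | q
      · exact ⟨by linarith, by linarith⟩
      · exact (no_real_solution_of_two_eq a b c τ (by linarith) (by linarith) (by linarith)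
          (by linarith)).elim
    · rcases mul_eq_zero.mp hbc with q | q
      · exact (no_real_solution_of_two_eq b c a τ (by linarith) (by linarith) (by linarith)
          (by linarith)).elim
      · exact (no_real_solution_of_two_eq a c b τ (by linarith) (by linarith) (by linarith)
          (by linarith)).elim
  obtain ⟨rfl, rfl⟩ := key
  obtain rfl : a = -τ / 12 := by linarith
  have d0 : d = 0 := pow_eq_zero_iff two_ne_zero |>.mp (by rw [hd]; ring)
  have e0 : e = 0 := pow_eq_zero_iff two_ne_zero |>.mp (by rw [he]; ring)
  have f0 : f = 0 := pow_eq_zero_iff two_ne_zero |>.mp (by rw [hf]; ring)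
  subst d0 e0 f0
  refine ⟨rfl, rfl, rfl, rfl, rfl, rfl, ?_⟩
  have : (τ - 12) * (τ - 24) = 0 := by linear_combination (-1 / 2) * h410
  rcases mul_eq_zero.mp this with h | h
  · exact Or.inl (by linarith)
  · exact Or.inr (by linarith)
end
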